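/- Let (T, ⪯, f) be an order-theoretic merge tree in which any two points have a least upper bound and every point has a leaf below it. Then the map sending a consistent layer-order on T to its induced leaf-order, and the map sending a leaf-order on T to its induced layer-order, are mutually inverse; in particular they define a bijection between the set of consistent layer-orders on T and the set of leaf-orders on T. -/

import Mathlib

/-- An order-theoretic merge tree: a partially ordered set with a real-valued
height function that is strictly monotone, whose ancestors form chains, and in
which every point can be lifted to any height above it. `up x h` is the
(necessarily unique) ancestor of `x` at height `h` (for `f x ≤ h`). -/
structure MergeTree (T : Type*) [PartialOrder T] where
  f : T → ℝ
  up : T → ℝ → T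
  strict_mono : ∀ {x y : T}, x < y → f x < f y
  chain : ∀ {x y z : T}, x ≤ y → x ≤ z → y ≤ z ∨ z ≤ y
  le_up : ∀ (x : T) (h : ℝ), f x ≤ h → x ≤ up x h
  f_up : ∀ (x : T) (h : ℝ), f x ≤ h → f (up x h) = h

/-- A consistent layer-order on a merge tree: for every height `h`, a total
order on the level set `T_h = {x | f x = h}`, consistent with lifting. -/
structure LayerOrder {T : Type*} [PartialOrder T] (M : MergeTree T) where
  le : ℝ → T → T → Prop
  refl : ∀ (h : ℝ) (x : T), M.f x = h → le h x x
  antisymm : ∀ (h : ℝ) (x y : T), M.f x = h → M.f y = h → le h x y → le h y x → x = y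
  trans : ∀ (h : ℝ) (x y z : T), M.f x = h → M.f y = h → M.f z = h →
    le h x y → le h y z → le h x z
  total : ∀ (h : ℝ) (x y : T), M.f x = h → M.f y = h → le h x y ∨ le h y x
  consistent : ∀ (h₁ h₂ : ℝ), h₁ ≤ h₂ → ∀ (x y : T), M.f x = h₁ → M.f y = h₁ →
    le h₁ x y → le h₂ (M.up x h₂) (M.up y h₂)

/-- A leaf of a merge tree is a minimal element. -/
def IsLeaf {T : Type*} [PartialOrder T] (x : T) : Prop := ∀ y : T, y ≤ x → y = x

/-- `lay` is a consistent layer-order: a family of total orders on the level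
sets `T_h` (the relation `lay h` only relates points of height `h`), which is
consistent with lifting. -/
def IsConsistentLayerOrder {T : Type*} [PartialOrder T] (M : MergeTree T)
    (lay : ℝ → T → T → Prop) : Prop :=
  (∀ (h : ℝ) (x y : T), lay h x y → M.f x = h ∧ M.f y = h) ∧
  (∀ (h : ℝ) (x : T), M.f x = h → lay h x x) ∧
  (∀ (h : ℝ) (x y : T), lay h x y → lay h y x → x = y) ∧
  (∀ (h : ℝ) (x y z : T), lay h x y → lay h y z → lay h x z) ∧
  (∀ (h : ℝ) (x y : T), M.f x = h → M.f y = h → lay h x y ∨ lay h y x) ∧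
  (∀ (h₁ h₂ : ℝ), h₁ ≤ h₂ → ∀ (x y : T), lay h₁ x y →
    lay h₂ (M.up x h₂) (M.up y h₂))

/-- `lle` is a leaf-order: a total order on the leaves (the relation only
relates leaves) that separates subtrees (`⊔` = lca). -/
def IsLeafOrder {T : Type*} [SemilatticeSup T] (lle : T → T → Prop) : Prop :=
  (∀ u v : T, lle u v → IsLeaf u ∧ IsLeaf v) ∧
  (∀ u : T, IsLeaf u → lle u u) ∧
  (∀ u v : T, lle u v → lle v u → u = v) ∧
  (∀ u v w : T, lle u v → lle v w → lle u w) ∧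
  (∀ u v : T, IsLeaf u → IsLeaf v → lle u v ∨ lle v u) ∧
  (∀ u u1 u2 : T, IsLeaf u → lle u1 u → lle u u2 → u ≤ u1 ⊔ u2)

/-- The leaf-order induced by a layer-order: for leaves `u1, u2`,
`u1 ⊑_L u2` iff `u1^h ≤_h u2^h` where `h = max (f u1) (f u2)`. -/
def inducedLeafRel {T : Type*} [PartialOrder T] (M : MergeTree T)
    (lay : ℝ → T → T → Prop) (u1 u2 : T) : Prop :=
  IsLeaf u1 ∧ IsLeaf u2 ∧
    lay (max (M.f u1) (M.f u2))
      (M.up u1 (max (M.f u1) (M.f u2))) (M.up u2 (max (M.f u1) (M.f u2)))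

/-- The layer-order induced by a leaf-order: for `x1, x2` at height `h`,
`x1 ≤_h x2` iff `x1 = x2` or `L(T_{x1}) ⊑_L L(T_{x2})`. -/
def inducedLayerRel {T : Type*} [PartialOrder T] (M : MergeTree T)
    (lle : T → T → Prop) (h : ℝ) (x1 x2 : T) : Prop :=
  M.f x1 = h ∧ M.f x2 = h ∧
    (x1 = x2 ∨ ∀ u1 : T, IsLeaf u1 → u1 ≤ x1 → ∀ u2 : T, IsLeaf u2 → u2 ≤ x2 → lle u1 u2)

namespace MergeTree

variable {T : Type*}

section PartialOrder

variable [PartialOrder T] (M : MergeTree T)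

theorem f_mono {x y : T} (h : x ≤ y) : M.f x ≤ M.f y := by
  rcases h.eq_or_lt with rfl | h
  · exact le_rfl
  · exact (M.strict_mono h).le

theorem eq_of_le_of_f_eq {x y : T} (h : x ≤ y) (hf : M.f x = M.f y) : x = y := by
  by_contra hne
  exact (M.strict_mono (lt_of_le_of_ne h hne)).ne hf

theorem eq_of_common_le {u x y : T} (hx : u ≤ x) (hy : u ≤ y) (hf : M.f x = M.f y) : x = y := by
  rcases M.chain hx hy with h | h
  · exact M.eq_of_le_of_f_eq h hf
  · exact (M.eq_of_le_of_f_eq h hf.symm).symm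

theorem up_eq {x y : T} {h : ℝ} (hxy : x ≤ y) (hy : M.f y = h) : M.up x h = y := by
  have hx : M.f x ≤ h := hy ▸ M.f_mono hxy
  exact M.eq_of_common_le (M.le_up x h hx) hxy ((M.f_up x h hx).trans hy.symm)

theorem up_self (x : T) : M.up x (M.f x) = x :=
  M.up_eq le_rfl rfl

theorem up_up {x : T} {h₁ h₂ : ℝ} (hx : M.f x ≤ h₁) (h : h₁ ≤ h₂) :
    M.up (M.up x h₁) h₂ = M.up x h₂ := by
  have h' : M.f (M.up x h₁) ≤ h₂ := (M.f_up x h₁ hx).trans_le h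
  exact (M.up_eq ((M.le_up x h₁ hx).trans (M.le_up _ _ h')) (M.f_up _ _ h')).symm

theorem leaf_eq_of_up_max_eq {u v : T} (hu : IsLeaf u) (hv : IsLeaf v)
    (h : M.up u (max (M.f u) (M.f v)) = M.up v (max (M.f u) (M.f v))) : u = v := by
  rcases le_total (M.f u) (M.f v) with huv | huv
  · rw [max_eq_right huv, M.up_self] at h
    exact hv u (h ▸ M.le_up u _ huv)
  · rw [max_eq_left huv, M.up_self] at h
    exact (hu v (h ▸ M.le_up v _ huv)).symm

end PartialOrder

end MergeTree

section LayerToLeaf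

variable {T : Type*}

theorem inducedLeafRel.lay_up [PartialOrder T] {M : MergeTree T} {lay : ℝ → T → T → Prop}
    (H : IsConsistentLayerOrder M lay) {u v : T} (huv : inducedLeafRel M lay u v) {h : ℝ}
    (hu : M.f u ≤ h) (hv : M.f v ≤ h) : lay h (M.up u h) (M.up v h) := by
  obtain ⟨-, -, -, -, -, h_consistent⟩ := H
  have := h_consistent _ h (max_le hu hv) _ _ huv.2.2
  rwa [M.up_up (le_max_left _ _) (max_le hu hv), M.up_up (le_max_right _ _) (max_le hu hv)] at this

theorem IsConsistentLayerOrder.inducedLeafRel_total [PartialOrder T] {M : MergeTree T}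
    {lay : ℝ → T → T → Prop} (H : IsConsistentLayerOrder M lay) {u v : T}
    (hu : IsLeaf u) (hv : IsLeaf v) : inducedLeafRel M lay u v ∨ inducedLeafRel M lay v u := by
  obtain ⟨-, -, -, -, h_total, -⟩ := H
  rcases h_total _ _ _ (M.f_up u _ (le_max_left (M.f u) (M.f v)))
    (M.f_up v _ (le_max_right (M.f u) (M.f v))) with h | h
  · exact Or.inl ⟨hu, hv, h⟩
  · refine Or.inr ⟨hv, hu, ?_⟩
    rwa [max_comm]

theorem IsConsistentLayerOrder.inducedLeafRel_of_lay_up [PartialOrder T] {M : MergeTree T}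
    {lay : ℝ → T → T → Prop} (H : IsConsistentLayerOrder M lay) {u v : T}
    (hu : IsLeaf u) (hv : IsLeaf v) {h : ℝ} (hfu : M.f u ≤ h) (hfv : M.f v ≤ h)
    (hlay : lay h (M.up u h) (M.up v h)) (hne : M.up u h ≠ M.up v h) :
    inducedLeafRel M lay u v := by
  rcases H.inducedLeafRel_total hu hv with h' | h'
  · exact h'
  · exact absurd (H.2.2.1 _ _ _ hlay (h'.lay_up H hfv hfu)) hne

theorem IsConsistentLayerOrder.isLeafOrder [SemilatticeSup T] {M : MergeTree T}
    {lay : ℝ → T → T → Prop} (H : IsConsistentLayerOrder M lay) :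
    IsLeafOrder (inducedLeafRel M lay) := by
  have ⟨_, h_refl, h_antisymm, h_trans, _, _⟩ := H
  have leaf_antisymm : ∀ u v, inducedLeafRel M lay u v → inducedLeafRel M lay v u → u = v := by
    intro u v huv hvu
    exact M.leaf_eq_of_up_max_eq huv.1 huv.2.1 (h_antisymm _ _ _ huv.2.2
      (hvu.lay_up H (le_max_right _ _) (le_max_left _ _)))
  have leaf_refl : ∀ u, IsLeaf u → inducedLeafRel M lay u u := fun u hu =>
    ⟨hu, hu, h_refl _ _ (M.f_up u _ (le_max_left _ _))⟩
  refine ⟨fun u v h => ⟨h.1, h.2.1⟩, leaf_refl, leaf_antisymm, ?_,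
    fun u v hu hv => H.inducedLeafRel_total hu hv, ?_⟩
  · intro u v w huv hvw
    have key : ∀ h, M.f u ≤ h → M.f v ≤ h → M.f w ≤ h → lay h (M.up u h) (M.up w h) :=
      fun h hu hv hw => h_trans _ _ _ _ (huv.lay_up H hu hv) (hvw.lay_up H hv hw)
    rcases le_total (M.f v) (max (M.f u) (M.f w)) with hv | hv
    · exact ⟨huv.1, hvw.2.1, key _ (le_max_left _ _) hv (le_max_right _ _)⟩
    · have hu := (le_max_left _ _).trans hv
      have hw := (le_max_right _ _).trans hv
      by_cases heq : M.up u (M.f v) = M.up w (M.f v)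
      · have hvu := h_antisymm _ _ _ (huv.lay_up H hu le_rfl) (heq ▸ hvw.lay_up H le_rfl hw)
        rw [M.up_self] at hvu
        have : u = v := huv.2.1 u (hvu ▸ M.le_up u _ hu)
        exact this ▸ hvw
      · exact H.inducedLeafRel_of_lay_up huv.1 hvw.2.1 hu hw (key _ hu le_rfl hw) heq
  · intro u u₁ u₂ hu h₁ h₂
    have hz := le_max_left (M.f (u₁ ⊔ u₂)) (M.f u)
    have hfu := le_max_right (M.f (u₁ ⊔ u₂)) (M.f u)
    have e₁ := M.up_eq (le_sup_left.trans (M.le_up (u₁ ⊔ u₂) _ hz)) (M.f_up _ _ hz)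
    have e₂ := M.up_eq (le_sup_right.trans (M.le_up (u₁ ⊔ u₂) _ hz)) (M.f_up _ _ hz)
    have l₁ := h₁.lay_up H ((M.f_mono le_sup_left).trans hz) hfu
    have l₂ := h₂.lay_up H hfu ((M.f_mono le_sup_right).trans hz)
    rw [e₁] at l₁
    rw [e₂] at l₂
    have e := h_antisymm _ _ _ l₁ l₂
    rcases le_total (M.f u) (M.f (u₁ ⊔ u₂)) with hle | hle
    · rw [max_eq_left hle, M.up_self] at e
      exact e ▸ M.le_up u _ hle
    · rw [max_eq_right hle, M.up_self] at e
      exact (hu _ (e ▸ M.le_up _ _ hle)).ge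

theorem IsConsistentLayerOrder.inducedLayerRel_inducedLeafRel [PartialOrder T] {M : MergeTree T}
    {lay : ℝ → T → T → Prop} (H : IsConsistentLayerOrder M lay)
    (hleaf : ∀ x : T, ∃ u : T, IsLeaf u ∧ u ≤ x) :
    inducedLayerRel M (inducedLeafRel M lay) = lay := by
  have ⟨h_level, h_refl, _⟩ := H
  ext h x y
  constructor
  · rintro ⟨hx, hy, rfl | hxy⟩
    · exact h_refl _ _ hx
    · obtain ⟨u, hu, hux⟩ := hleaf x
      obtain ⟨v, hv, hvy⟩ := hleaf y
      have := (hxy u hu hux v hv hvy).lay_up H (hx ▸ M.f_mono hux) (hy ▸ M.f_mono hvy)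
      rwa [M.up_eq hux hx, M.up_eq hvy hy] at this
  · intro hlay
    obtain ⟨hx, hy⟩ := h_level _ _ _ hlay
    refine ⟨hx, hy, or_iff_not_imp_left.mpr fun hne u hu hux v hv hvy => ?_⟩
    rw [← M.up_eq hux hx, ← M.up_eq hvy hy] at hlay hne
    exact H.inducedLeafRel_of_lay_up hu hv (hx ▸ M.f_mono hux) (hy ▸ M.f_mono hvy) hlay hne

end LayerToLeaf

section LeafToLayer

variable {T : Type*} [SemilatticeSup T] {lle : T → T → Prop}

theorem IsLeafOrder.inducedLayerRel_total (H : IsLeafOrder lle) (M : MergeTree T) {h : ℝ}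
    {x y : T} (hx : M.f x = h) (hy : M.f y = h) :
    inducedLayerRel M lle h x y ∨ inducedLayerRel M lle h y x := by
  obtain ⟨-, -, -, -, h_total, h_separates⟩ := H
  by_cases hne : x = y
  · exact Or.inl ⟨hx, hy, Or.inl hne⟩
  have h_disjoint : ∀ u, u ≤ x → ¬ u ≤ y := fun u hux huy =>
    hne (M.eq_of_common_le hux huy (hx.trans hy.symm))
  by_contra! hcon
  have hxy : ¬ ∀ u₁, IsLeaf u₁ → u₁ ≤ x → ∀ u₂, IsLeaf u₂ → u₂ ≤ y → lle u₁ u₂ :=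
    fun h' => hcon.1 ⟨hx, hy, Or.inr h'⟩
  have hyx : ¬ ∀ u₁, IsLeaf u₁ → u₁ ≤ y → ∀ u₂, IsLeaf u₂ → u₂ ≤ x → lle u₁ u₂ :=
    fun h' => hcon.2 ⟨hy, hx, Or.inr h'⟩
  push Not at hxy hyx
  obtain ⟨u₁, hu₁, hu₁x, u₂, hu₂, hu₂y, hu⟩ := hxy
  obtain ⟨v₂, hv₂, hv₂y, v₁, hv₁, hv₁x, hv⟩ := hyx
  have hu' := (h_total _ _ hu₁ hu₂).resolve_left hu
  have hv' := (h_total _ _ hv₂ hv₁).resolve_left hv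
  rcases h_total _ _ hu₁ hv₂ with h' | h'
  · exact h_disjoint u₁ hu₁x ((h_separates _ _ _ hu₁ hu' h').trans (sup_le hu₂y hv₂y))
  · exact h_disjoint v₂ ((h_separates _ _ _ hv₂ hv' h').trans (sup_le hv₁x hu₁x)) hv₂y

/-- A comparison between two leaves determines the order of the points above them. -/
theorem IsLeafOrder.inducedLayerRel_of_lle (H : IsLeafOrder lle) (M : MergeTree T) {h : ℝ}
    {u v x y : T} (huv : lle u v) (hux : u ≤ x) (hvy : v ≤ y) (hx : M.f x = h) (hy : M.f y = h) :
    inducedLayerRel M lle h x y := by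
  rcases H.inducedLayerRel_total M hx hy with h' | ⟨-, -, h' | h'⟩
  · exact h'
  · exact ⟨hx, hy, Or.inl h'.symm⟩
  · have ⟨hu, hv⟩ := H.1 _ _ huv
    have : u = v := H.2.2.1 _ _ huv (h' v hv hvy u hu hux)
    exact ⟨hx, hy, Or.inl (M.eq_of_common_le hux (this ▸ hvy) (hx.trans hy.symm))⟩

theorem IsLeafOrder.isConsistentLayerOrder (H : IsLeafOrder lle) (M : MergeTree T)
    (hleaf : ∀ x : T, ∃ u : T, IsLeaf u ∧ u ≤ x) :
    IsConsistentLayerOrder M (inducedLayerRel M lle) := by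
  have ⟨_, _, h_antisymm, h_trans, _, _⟩ := H
  refine ⟨fun h x y hxy => ⟨hxy.1, hxy.2.1⟩, fun h x hx => ⟨hx, hx, Or.inl rfl⟩, ?_, ?_,
    fun h x y hx hy => H.inducedLayerRel_total M hx hy, ?_⟩
  · rintro h x y ⟨hx, hy, hxy | hxy⟩ ⟨-, -, hyx | hyx⟩
    · exact hxy
    · exact hxy
    · exact hyx.symm
    · obtain ⟨u, hu, hux⟩ := hleaf x
      obtain ⟨v, hv, hvy⟩ := hleaf y
      have : u = v := h_antisymm _ _ (hxy u hu hux v hv hvy) (hyx v hv hvy u hu hux)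
      exact M.eq_of_common_le hux (this ▸ hvy) (hx.trans hy.symm)
  · rintro h x y z ⟨hx, hy, rfl | hxy⟩ ⟨-, hz, rfl | hyz⟩
    · exact ⟨hx, hz, Or.inl rfl⟩
    · exact ⟨hx, hz, Or.inr hyz⟩
    · exact ⟨hx, hz, Or.inr hxy⟩
    · obtain ⟨v, hv, hvy⟩ := hleaf y
      exact ⟨hx, hz, Or.inr fun u hu hux w hw hwz =>
        h_trans _ _ _ (hxy u hu hux v hv hvy) (hyz v hv hvy w hw hwz)⟩
  · rintro h₁ h₂ hle x y ⟨hx, hy, hxy⟩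
    have hx₂ := hx.trans_le hle
    have hy₂ := hy.trans_le hle
    rcases hxy with rfl | hxy
    · exact ⟨M.f_up _ _ hx₂, M.f_up _ _ hx₂, Or.inl rfl⟩
    · obtain ⟨u, hu, hux⟩ := hleaf x
      obtain ⟨v, hv, hvy⟩ := hleaf y
      exact H.inducedLayerRel_of_lle M (hxy u hu hux v hv hvy) (hux.trans (M.le_up _ _ hx₂))
        (hvy.trans (M.le_up _ _ hy₂)) (M.f_up _ _ hx₂) (M.f_up _ _ hy₂)

theorem IsLeafOrder.inducedLeafRel_inducedLayerRel (H : IsLeafOrder lle) (M : MergeTree T) :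
    inducedLeafRel M (inducedLayerRel M lle) = lle := by
  ext u v
  have hu' := le_max_left (M.f u) (M.f v)
  have hv' := le_max_right (M.f u) (M.f v)
  constructor
  · rintro ⟨hu, hv, -, -, heq | hlle⟩
    · exact M.leaf_eq_of_up_max_eq hu hv heq ▸ H.2.1 u hu
    · exact hlle u hu (M.le_up _ _ hu') v hv (M.le_up _ _ hv')
  · intro huv
    have ⟨hu, hv⟩ := H.1 _ _ huv
    exact ⟨hu, hv, H.inducedLayerRel_of_lle M huv (M.le_up _ _ hu') (M.le_up _ _ hv')
      (M.f_up _ _ hu') (M.f_up _ _ hv')⟩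

end LeafToLayer

/-- In a merge tree with binary least upper bounds in which every
point has a leaf below it, the map sending a consistent layer-order to its
induced leaf-order and the map sending a leaf-order to its induced layer-order
are mutually inverse: they constitute a bijection (an `Equiv`) between the set
of consistent layer-orders and the set of leaf-orders. -/
theorem layerOrder_leafOrder_bijection {T : Type*} [SemilatticeSup T]
    (M : MergeTree T) (hleaf : ∀ x : T, ∃ u : T, IsLeaf u ∧ u ≤ x) :
    ∃ F : {lay : ℝ → T → T → Prop // IsConsistentLayerOrder M lay} ≃
          {lle : T → T → Prop // IsLeafOrder lle},
      (∀ lay : {lay : ℝ → T → T → Prop // IsConsistentLayerOrder M lay},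
        (F lay).1 = inducedLeafRel M lay.1) ∧
      (∀ lle : {lle : T → T → Prop // IsLeafOrder lle},
        (F.symm lle).1 = inducedLayerRel M lle.1) := by
  exact ⟨{
    toFun lay := ⟨inducedLeafRel M lay.1, lay.2.isLeafOrder⟩
    invFun lle := ⟨inducedLayerRel M lle.1, lle.2.isConsistentLayerOrder M hleaf⟩
    left_inv lay := Subtype.ext (lay.2.inducedLayerRel_inducedLeafRel hleaf)
    right_inv lle := Subtype.ext (lle.2.inducedLeafRel_inducedLayerRel M) },
    fun _ => rfl, fun _ => rfl⟩
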